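/- Let G_r and G_a be finite nonempty sets with injective score functions s_r : G_r → ℝ and s_a : G_a → ℝ. Write n = |G_r|, m = |G_a|, let F_r and F_a be the empirical CDFs of (G_r, s_r) and (G_a, s_a), let F_r⁻¹ be the generalized inverse of F_r, and define F_{a→r}(t) = (1/m)·|{x ∈ G_a : F_r⁻¹(F_a(s_a(x))) ≤ t}|. Then for every integer l with 1 ≤ l ≤ n, |F_{a→r}(F_r⁻¹(l/n)) − l/n| < 1/m (strict inequality). -/

import Mathlib

/-- Empirical cumulative distribution function of the scores `s` on the finite set `G`:
`F(t) = |{x : s x ≤ t}| / |G|`. -/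
noncomputable def ecdf {G : Type*} [Fintype G] (s : G → ℝ) (t : ℝ) : ℝ :=
  ((Finset.univ.filter (fun x => s x ≤ t)).card : ℝ) / (Fintype.card G : ℝ)

/-- Generalized inverse (quantile function) of the empirical CDF:
`F⁻¹(α) = inf {t : F(t) ≥ α}`. -/
noncomputable def equantile {G : Type*} [Fintype G] (s : G → ℝ) (α : ℝ) : ℝ :=
  sInf {t : ℝ | α ≤ ecdf s t}

/-- Empirical survival function of the scores `s` on the finite set `G`:
`S(t) = |{x : s x > t}| / |G|`. -/
noncomputable def esurv {G : Type*} [Fintype G] (s : G → ℝ) (t : ℝ) : ℝ :=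
  ((Finset.univ.filter (fun x => s x > t)).card : ℝ) / (Fintype.card G : ℝ)

/-- Generalized inverse of the empirical survival function, defined through the
CDF `1 - S`: `S⁻¹(α) = inf {t : 1 - S(t) ≥ 1 - α}`. -/
noncomputable def esurvInv {G : Type*} [Fintype G] (s : G → ℝ) (α : ℝ) : ℝ :=
  sInf {t : ℝ | 1 - α ≤ 1 - esurv s t}

open Classical in
noncomputable def rk {G : Type*} [Fintype G] (s : G → ℝ) (x : G) : ℕ :=
  (Finset.univ.filter (fun y => s y ≤ s x)).card

lemma ecdf_rk {G : Type*} [Fintype G] (s : G → ℝ) (x : G) :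
    ecdf s (s x) = (rk s x : ℝ) / (Fintype.card G : ℝ) := by
  unfold ecdf rk
  congr!

lemma ecdf_mono' {G : Type*} [Fintype G] (s : G → ℝ) {t u : ℝ} (h : t ≤ u) :
    ecdf s t ≤ ecdf s u := by
  unfold ecdf
  apply div_le_div_of_nonneg_right _ (Nat.cast_nonneg _)
  exact_mod_cast Finset.card_le_card (fun x hx => by
    simp only [Finset.mem_filter, Finset.mem_univ, true_and] at hx ⊢
    exact hx.trans h)

lemma rk_lt {G : Type*} [Fintype G] (s : G → ℝ) {x y : G} (h : s x < s y) :
    rk s x < rk s y := by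
  unfold rk
  apply Finset.card_lt_card
  rw [Finset.ssubset_iff_of_subset]
  · exact ⟨y, by simp, by simpa using h⟩
  · intro z hz
    simp only [Finset.mem_filter, Finset.mem_univ, true_and] at hz ⊢
    exact hz.trans h.le

lemma rk_inj {G : Type*} [Fintype G] (s : G → ℝ) (hs : Function.Injective s) :
    Function.Injective (rk s) := by
  intro x y h
  apply hs
  rcases lt_trichotomy (s x) (s y) with h1 | h1 | h1
  · have := rk_lt s h1
    omega
  · exact h1
  · have := rk_lt s h1
    omega

lemma rk_image {G : Type*} [Fintype G] (s : G → ℝ) (hs : Function.Injective s) :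
    Finset.univ.image (rk s) = Finset.Icc 1 (Fintype.card G) := by
  apply Finset.eq_of_subset_of_card_le
  · intro k hk
    simp only [Finset.mem_image, Finset.mem_univ, true_and] at hk
    obtain ⟨x, rfl⟩ := hk
    rw [Finset.mem_Icc]
    refine ⟨Finset.card_pos.mpr ⟨x, by simp⟩, ?_⟩
    exact Finset.card_le_univ _
  · rw [Finset.card_image_of_injective _ (rk_inj s hs)]
    simp

lemma rk_count {G : Type*} [Fintype G] (s : G → ℝ) (hs : Function.Injective s)
    (k : ℕ) (hk : k ≤ Fintype.card G) :
    (Finset.univ.filter (fun x => rk s x ≤ k)).card = k := by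
  rw [← Finset.card_image_of_injective _ (rk_inj s hs)]
  have : (Finset.univ.filter (fun x => rk s x ≤ k)).image (rk s) = Finset.Icc 1 k := by
    ext j
    have := Finset.ext_iff.mp (rk_image s hs) j
    simp only [Finset.mem_image, Finset.mem_univ, true_and, Finset.mem_Icc,
      Finset.mem_filter] at this ⊢
    constructor
    · rintro ⟨x, hx, rfl⟩
      exact ⟨(this.mp ⟨x, rfl⟩).1, hx⟩
    · rintro ⟨h1, h2⟩
      obtain ⟨x, rfl⟩ := this.mpr ⟨h1, h2.trans hk⟩
      exact ⟨x, h2, rfl⟩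
  rw [this]
  simp

lemma equantile_le_iff {G : Type*} [Fintype G] [Nonempty G] (s : G → ℝ) {α : ℝ}
    (h0 : 0 < α) (h1 : α ≤ 1) (t : ℝ) : equantile s α ≤ t ↔ α ≤ ecdf s t := by
  classical
  have hne : (Finset.univ.filter (fun x => α ≤ ecdf s (s x))).Nonempty := by
    obtain ⟨x, hx⟩ := Finite.exists_max s
    refine ⟨x, ?_⟩
    simp only [Finset.mem_filter, Finset.mem_univ, true_and]
    have : ecdf s (s x) = 1 := by
      unfold ecdf
      rw [Finset.filter_true_of_mem (fun y _ => hx y)]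
      simp
    rwa [this]
  obtain ⟨x0, hx0, hmin⟩ := Finset.exists_min_image _ s hne
  simp only [Finset.mem_filter, Finset.mem_univ, true_and] at hx0 hmin
  have hset : {t : ℝ | α ≤ ecdf s t} = Set.Ici (s x0) := by
    ext u
    simp only [Set.mem_setOf_eq, Set.mem_Ici]
    constructor
    · intro hu
      have hne' : (Finset.univ.filter (fun x => s x ≤ u)).Nonempty := by
        by_contra hcon
        rw [Finset.not_nonempty_iff_eq_empty] at hcon
        unfold ecdf at hu
        rw [hcon] at hu
        simp at hu
        linarith
      obtain ⟨x, hx, hmax⟩ := Finset.exists_max_image _ s hne'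
      simp only [Finset.mem_filter, Finset.mem_univ, true_and] at hx hmax
      have heq : ecdf s (s x) = ecdf s u := by
        unfold ecdf
        congr 3
        ext y
        simp only [Finset.mem_filter, Finset.mem_univ, true_and]
        exact ⟨fun h => h.trans hx, fun h => hmax y h⟩
      exact (hmin x (heq ▸ hu)).trans hx
    · intro hu
      exact hx0.trans (ecdf_mono' s hu)
  have hq : equantile s α = s x0 := by
    unfold equantile
    rw [hset, csInf_Ici]
  rw [hq]
  exact (Set.ext_iff.mp hset t).symm

/-- Strict pointwise bound at the jump points, in the proof of Proposition 1:
`|F_{a→r}(F_r⁻¹(l/n)) − l/n| < 1/m`. -/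
theorem strict_bound_at_jumps {Gr Ga : Type*} [Fintype Gr] [Fintype Ga]
    [Nonempty Gr] [Nonempty Ga]
    (sr : Gr → ℝ) (sa : Ga → ℝ)
    (hr_inj : Function.Injective sr) (ha_inj : Function.Injective sa)
    (l : ℕ) (hl1 : 1 ≤ l) (hln : l ≤ Fintype.card Gr) :
    |ecdf (fun x => equantile sr (ecdf sa (sa x)))
        (equantile sr ((l : ℝ) / (Fintype.card Gr : ℝ)))
      - (l : ℝ) / (Fintype.card Gr : ℝ)| < 1 / (Fintype.card Ga : ℝ) := by
  have hn : (0 : ℝ) < Fintype.card Gr := by exact_mod_cast Fintype.card_pos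
  have hm : (0 : ℝ) < Fintype.card Ga := by exact_mod_cast Fintype.card_pos
  have hnN : 0 < Fintype.card Gr := Fintype.card_pos
  have hl0 : (0 : ℝ) < l := by exact_mod_cast hl1
  have hα0 : 0 < (l : ℝ) / (Fintype.card Gr : ℝ) := by positivity
  have hα1 : (l : ℝ) / (Fintype.card Gr : ℝ) ≤ 1 := by
    rw [div_le_one hn]
    exact_mod_cast hln
  have hFq : ecdf sr (equantile sr ((l : ℝ) / (Fintype.card Gr : ℝ)))
      = (l : ℝ) / (Fintype.card Gr : ℝ) := by
    have hmem : l ∈ Finset.univ.image (rk sr) := by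
      rw [rk_image sr hr_inj, Finset.mem_Icc]
      exact ⟨hl1, hln⟩
    simp only [Finset.mem_image, Finset.mem_univ, true_and] at hmem
    obtain ⟨x, hx⟩ := hmem
    have hxe := ecdf_rk sr x
    rw [hx] at hxe
    apply le_antisymm
    · rw [← hxe]
      apply ecdf_mono'
      rw [equantile_le_iff sr (hxe ▸ hα0) (hxe ▸ hα1)]
    · exact (equantile_le_iff sr hα0 hα1 _).mp le_rfl
  have hdiv : l * Fintype.card Ga / Fintype.card Gr ≤ Fintype.card Ga := by
    apply Nat.div_le_of_le_mul
    exact Nat.mul_le_mul_right _ hln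
  have key : ecdf (fun x => equantile sr (ecdf sa (sa x)))
      (equantile sr ((l : ℝ) / (Fintype.card Gr : ℝ)))
      = ((l * Fintype.card Ga / Fintype.card Gr : ℕ) : ℝ) / (Fintype.card Ga : ℝ) := by
    rw [← rk_count sa ha_inj _ hdiv]
    conv_lhs => unfold ecdf
    congr 3
    ext x
    simp only [Finset.mem_filter, Finset.mem_univ, true_and]
    have hx : rk sa x ∈ Finset.Icc 1 (Fintype.card Ga) := by
      rw [← rk_image sa ha_inj]
      simp
    rw [Finset.mem_Icc] at hx
    have h0 : (0 : ℝ) < rk sa x := by exact_mod_cast hx.1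
    have h1 : (rk sa x : ℝ) ≤ Fintype.card Ga := by exact_mod_cast hx.2
    change equantile sr (ecdf sa (sa x)) ≤ _ ↔ _
    rw [ecdf_rk, equantile_le_iff sr (by positivity) ((div_le_one hm).mpr h1), hFq,
      div_le_div_iff₀ hm hn, Nat.le_div_iff_mul_le hnN]
    exact_mod_cast Iff.rfl
  rw [key]
  generalize hK : l * Fintype.card Ga / Fintype.card Gr = K
  have e1 : K * Fintype.card Gr ≤ l * Fintype.card Ga := hK ▸ Nat.div_mul_le_self _ _
  have e2 : l * Fintype.card Ga < (K + 1) * Fintype.card Gr := by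
    rw [← Nat.div_lt_iff_lt_mul hnN]
    omega
  have e1' : (K : ℝ) * Fintype.card Gr ≤ l * Fintype.card Ga := by exact_mod_cast e1
  have e2' : (l : ℝ) * Fintype.card Ga < (K + 1) * Fintype.card Gr := by exact_mod_cast e2
  have f1 : (K : ℝ) / Fintype.card Ga ≤ l / Fintype.card Gr := by
    rw [div_le_div_iff₀ hm hn]
    exact e1'
  have f2 : (l : ℝ) / Fintype.card Gr < (K + 1) / Fintype.card Ga := by
    rw [div_lt_div_iff₀ hn hm]
    exact e2'
  rw [add_div] at f2
  have : 0 < 1 / (Fintype.card Ga : ℝ) := by positivity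
  rw [abs_lt]
  constructor <;> linarith
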